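/- Let L be a mixed 1-stack 1-queue layout of G(k,ℓ) with k > 4 and ℓ > 6, let {u,v} be a queue-edge of G(k-3,ℓ) with u ≺ v, and let x1,…,x7 be queue-attachments of {u,v} in Ḡ(k-2,ℓ) with u ≺ x1 ≺ … ≺ x7 ≺ v. Then for 2 ≤ i ≤ 6 there is no vertex w of Ḡ(k-1,ℓ) attached to {v,x_i} that is a mixed-attachment with stack-edge {w,x_i} and satisfies x7 ≺ w ≺ v, and there is no vertex w of Ḡ(k-1,ℓ) attached to {u,x_i} that is a mixed-attachment with stack-edge {w,x_i} and satisfies u ≺ w ≺ x1. -/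

import Mathlib

/-- Vertices for the graphs `G(k,ℓ)`: two base vertices and, for each step `k`,
each oriented edge `(u,v)` and each index `i : Fin ℓ`, a potential attached vertex. -/
inductive PV (ℓ : ℕ) : Type where
  | A : PV ℓ
  | B : PV ℓ
  | att : ℕ → PV ℓ → PV ℓ → Fin ℓ → PV ℓ

/-- The (canonically oriented) edges of `G(k,ℓ)`: `G(1,ℓ)` is the single edge `(A,B)`,
and for `k > 1`, `G(k,ℓ)` is obtained from `G(k-1,ℓ)` by attaching `ℓ` new vertices
to each of its edges. -/
def Gedges (ℓ : ℕ) : ℕ → Set (PV ℓ × PV ℓ)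
  | 0 => ∅
  | 1 => {p | p = (PV.A, PV.B)}
  | (k + 2) => Gedges ℓ (k + 1) ∪
      {p | ∃ u v, ∃ i : Fin ℓ, (u, v) ∈ Gedges ℓ (k + 1) ∧
        (p = (PV.att (k + 2) u v i, u) ∨ p = (PV.att (k + 2) u v i, v))}

/-- The graph `G(k,ℓ)`. -/
def Gkl (k ℓ : ℕ) : SimpleGraph (PV ℓ) :=
  SimpleGraph.fromEdgeSet ((fun p => s(p.1, p.2)) '' Gedges ℓ k)

/-- The graph `Ḡ(k,ℓ)` induced by the edges of `G(k,ℓ)` that are not in `G(k-1,ℓ)`. -/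
def Gbar (k ℓ : ℕ) : SimpleGraph (PV ℓ) :=
  SimpleGraph.fromEdgeSet ((fun p => s(p.1, p.2)) '' (Gedges ℓ k \ Gedges ℓ (k - 1)))

/-- A mixed 1-stack 1-queue layout of a graph `G`: a strict total (linear) order `lt`
on the vertices together with an assignment of each edge to the stack (`isStack e`)
or to the queue (`¬ isStack e`), such that no two stack-edges cross and no two
queue-edges nest. -/
structure MixedLayout {V : Type} (G : SimpleGraph V) where
  lt : V → V → Prop
  isSTO : IsStrictTotalOrder V lt
  isStack : Sym2 V → Prop
  noCross : ∀ a b c d : V, G.Adj a b → G.Adj c d →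
    isStack s(a, b) → isStack s(c, d) → ¬(lt a c ∧ lt c b ∧ lt b d)
  noNest : ∀ a b c d : V, G.Adj a b → G.Adj c d →
    ¬isStack s(a, b) → ¬isStack s(c, d) → ¬(lt a c ∧ lt c d ∧ lt d b)

/-- `{a,b}` is an edge of the subgraph `H` that is a stack-edge in the layout `L`. -/
def SEdgeIn {V : Type} {G : SimpleGraph V} (L : MixedLayout G) (H : SimpleGraph V)
    (a b : V) : Prop :=
  H.Adj a b ∧ L.isStack s(a, b)

/-- `{a,b}` is an edge of the subgraph `H` that is a queue-edge in the layout `L`. -/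
def QEdgeIn {V : Type} {G : SimpleGraph V} (L : MixedLayout G) (H : SimpleGraph V)
    (a b : V) : Prop :=
  H.Adj a b ∧ ¬L.isStack s(a, b)

/-- `x` is a stack-attachment of the edge `{u,v}`: both `{x,u}` and `{x,v}` are
stack-edges. -/
def StackAtt {V : Type} {G : SimpleGraph V} (L : MixedLayout G) (x u v : V) : Prop :=
  SEdgeIn L G x u ∧ SEdgeIn L G x v

/-- `x` is a queue-attachment of the edge `{u,v}`: both `{x,u}` and `{x,v}` are
queue-edges. -/
def QueueAtt {V : Type} {G : SimpleGraph V} (L : MixedLayout G) (x u v : V) : Prop :=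
  QEdgeIn L G x u ∧ QEdgeIn L G x v

/-- `x` is a mixed-attachment of the edge `{u,v}`: one of `{x,u}`, `{x,v}` is a
stack-edge and the other is a queue-edge. -/
def MixedAtt {V : Type} {G : SimpleGraph V} (L : MixedLayout G) (x u v : V) : Prop :=
  (SEdgeIn L G x u ∧ QEdgeIn L G x v) ∨ (QEdgeIn L G x u ∧ SEdgeIn L G x v)

/-- `x` is one of the vertices of `Ḡ(k,ℓ)` attached to the edge `{u,v}`, i.e. both
`{x,u}` and `{x,v}` are edges of `Ḡ(k,ℓ)`. -/
def AttachedAt (ℓ k : ℕ) (x u v : PV ℓ) : Prop :=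
  (Gbar k ℓ).Adj x u ∧ (Gbar k ℓ).Adj x v

/-- A smiley face `⟨a,b,u,v,c,d⟩` formed by vertices and edges of the subgraph `H`
in the layout `L`: `a ≺ b ≺ u ≺ v ≺ c ≺ d`, the edges `{a,b}`, `{c,d}`, `{a,d}` of `H`
are queue-edges and the edge `{u,v}` of `H` is a stack-edge. -/
def Smiley {V : Type} {G : SimpleGraph V} (L : MixedLayout G) (H : SimpleGraph V)
    (a b u v c d : V) : Prop :=
  L.lt a b ∧ L.lt b u ∧ L.lt u v ∧ L.lt v c ∧ L.lt c d ∧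
  QEdgeIn L H a b ∧ QEdgeIn L H c d ∧ QEdgeIn L H a d ∧ SEdgeIn L H u v

theorem Gkl_mono (k ℓ : ℕ) : Gkl (k + 1) ℓ ≤ Gkl (k + 2) ℓ :=
  SimpleGraph.fromEdgeSet_mono (Set.image_mono fun _ hp => Or.inl hp)

theorem Gbar_le_Gkl (k ℓ : ℕ) : Gbar k ℓ ≤ Gkl k ℓ :=
  SimpleGraph.fromEdgeSet_mono (Set.image_mono Set.sdiff_subset)

theorem PV.att_ne_left {ℓ n : ℕ} (a b : PV ℓ) (i : Fin ℓ) : PV.att n a b i ≠ a := by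
  intro h
  have := congrArg sizeOf h
  simp at this
  omega

theorem PV.att_ne_right {ℓ n : ℕ} (a b : PV ℓ) (i : Fin ℓ) : PV.att n a b i ≠ b := by
  intro h
  have := congrArg sizeOf h
  simp at this
  omega

theorem Gkl_exists_attachments {k ℓ : ℕ} {a b : PV ℓ} (h : (Gkl (k + 1) ℓ).Adj a b) :
    ∃ f : Fin ℓ → PV ℓ, Function.Injective f ∧
      ∀ i, (Gkl (k + 2) ℓ).Adj (f i) a ∧ (Gkl (k + 2) ℓ).Adj (f i) b := by
  have oriented : ∀ a b : PV ℓ, (a, b) ∈ Gedges ℓ (k + 1) →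
      ∃ f : Fin ℓ → PV ℓ, Function.Injective f ∧
        ∀ i, (Gkl (k + 2) ℓ).Adj (f i) a ∧ (Gkl (k + 2) ℓ).Adj (f i) b := by
    intro a b hab
    refine ⟨PV.att (k + 2) a b, fun i j hij => by injection hij, fun i => ⟨?_, ?_⟩⟩
    · exact (SimpleGraph.fromEdgeSet_adj _).2
        ⟨⟨_, Or.inr ⟨a, b, i, hab, Or.inl rfl⟩, rfl⟩, PV.att_ne_left a b i⟩
    · exact (SimpleGraph.fromEdgeSet_adj _).2
        ⟨⟨_, Or.inr ⟨a, b, i, hab, Or.inr rfl⟩, rfl⟩, PV.att_ne_right a b i⟩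
  obtain ⟨⟨⟨c, d⟩, hcd, he⟩, -⟩ := (SimpleGraph.fromEdgeSet_adj _).1 h
  rcases Sym2.eq_iff.1 he with ⟨rfl, rfl⟩ | ⟨rfl, rfl⟩
  · exact oriented _ _ hcd
  · obtain ⟨f, hf, hadj⟩ := oriented _ _ hcd
    exact ⟨f, hf, fun i => (hadj i).symm⟩

/-- An edge of `G(k+1,ℓ)` has an attached vertex in `G(k+2,ℓ)` outside any set of fewer than
`ℓ` vertices. -/
theorem Gkl_exists_attachment_notMem {k ℓ : ℕ} {a b : PV ℓ} (h : (Gkl (k + 1) ℓ).Adj a b)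
    (l : List (PV ℓ)) (hl : l.length < ℓ) :
    ∃ t, t ∉ l ∧ (Gkl (k + 2) ℓ).Adj t a ∧ (Gkl (k + 2) ℓ).Adj t b := by
  classical
  obtain ⟨f, hf, hadj⟩ := Gkl_exists_attachments h
  by_contra! hcon
  have hsub : Finset.univ.image f ⊆ l.toFinset := by
    intro t ht
    obtain ⟨i, -, rfl⟩ := Finset.mem_image.1 ht
    by_contra hmem
    exact hcon _ (fun hm => hmem (List.mem_toFinset.2 hm)) (hadj i).1 (hadj i).2
  have hcard := Finset.card_le_card hsub
  rw [Finset.card_image_of_injective _ hf, Finset.card_univ, Fintype.card_fin] at hcard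
  have := l.toFinset_card_le
  omega

namespace MixedLayout

variable {V : Type} {G : SimpleGraph V} (L : MixedLayout G)

theorem lt_trans {a b c : V} (hab : L.lt a b) (hbc : L.lt b c) : L.lt a c :=
  L.isSTO.toIsTrans.trans _ _ _ hab hbc

theorem lt_or_gt {a b : V} (h : a ≠ b) : L.lt a b ∨ L.lt b a := by
  have := L.isSTO
  rcases trichotomous_of L.lt a b with h' | h' | h'
  exacts [Or.inl h', (h h').elim, Or.inr h']

theorem sEdgeIn_symm {a b : V} (h : SEdgeIn L G a b) : SEdgeIn L G b a :=
  ⟨h.1.symm, Sym2.eq_swap (a := a) (b := b) ▸ h.2⟩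

theorem qEdgeIn_symm {a b : V} (h : QEdgeIn L G a b) : QEdgeIn L G b a :=
  ⟨h.1.symm, Sym2.eq_swap (a := a) (b := b) ▸ h.2⟩

theorem not_cross {a b c d : V} (hab : SEdgeIn L G a b) (hcd : SEdgeIn L G c d)
    (h₁ : L.lt a c) (h₂ : L.lt c b) (h₃ : L.lt b d) : False :=
  L.noCross a b c d hab.1 hcd.1 hab.2 hcd.2 ⟨h₁, h₂, h₃⟩

theorem not_nest {a b c d : V} (hab : QEdgeIn L G a b) (hcd : QEdgeIn L G c d)
    (h₁ : L.lt a c) (h₂ : L.lt c d) (h₃ : L.lt d b) : False :=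
  L.noNest a b c d hab.1 hcd.1 hab.2 hcd.2 ⟨h₁, h₂, h₃⟩

/-- A vertex strictly below a stack-edge `{a,c}`, where `{u,a}`, `{c,v}` and `{u,v}` are
queue-edges with `u ≺ a ≺ c ≺ v`, can only have stack-edges to further vertices, all of
which lie strictly below `{a,c}` as well. -/
theorem neighbor_below {u a c v p q : V} (huv : QEdgeIn L G u v) (hua : QEdgeIn L G u a)
    (hcv : QEdgeIn L G c v) (hac : SEdgeIn L G a c) (hlua : L.lt u a) (hlcv : L.lt c v)
    (hap : L.lt a p) (hpc : L.lt p c) (hpq : G.Adj p q)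
    (hqa : q ≠ a) (hqc : q ≠ c) (hqu : q ≠ u) (hqv : q ≠ v) :
    SEdgeIn L G p q ∧ L.lt a q ∧ L.lt q c := by
  by_cases hs : L.isStack s(p, q)
  · have hpq' : SEdgeIn L G p q := ⟨hpq, hs⟩
    refine ⟨hpq', ?_, ?_⟩
    · refine (L.lt_or_gt hqa).resolve_left fun h => ?_
      exact L.not_cross (L.sEdgeIn_symm hpq') hac h hap hpc
    · refine (L.lt_or_gt hqc).resolve_right fun h => ?_
      exact L.not_cross hac hpq' hap hpc h
  · exfalso
    have hpq' : QEdgeIn L G p q := ⟨hpq, hs⟩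
    rcases L.lt_or_gt hqu with hq | hq
    · exact L.not_nest (L.qEdgeIn_symm hpq') hua hq hlua hap
    rcases L.lt_or_gt hqv with hq' | hq'
    · rcases L.lt_or_gt hpq.ne with h | h
      · exact L.not_nest huv hpq' (L.lt_trans hlua hap) h hq'
      · exact L.not_nest huv (L.qEdgeIn_symm hpq') hq h (L.lt_trans hpc hlcv)
    · exact L.not_nest hpq' hcv hpc hlcv hq'

/-- Two distinct vertices `t`, `t'` attached by stack-edges to `p ≺ q` are separated by the
edge `{p,q}`: exactly one of them lies between `p` and `q`. -/
theorem stack_common_neighbors {p q t t' : V} (hpq : L.lt p q) (htt' : t ≠ t')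
    (htp : SEdgeIn L G t p) (htq : SEdgeIn L G t q)
    (htp' : SEdgeIn L G t' p) (htq' : SEdgeIn L G t' q) :
    (L.lt p t ∧ L.lt t q) ↔ ¬(L.lt p t' ∧ L.lt t' q) := by
  wlog h : L.lt t t' generalizing t t'
  · have := this htt'.symm htp' htq' htp htq ((L.lt_or_gt htt').resolve_left h)
    tauto
  have hpt := L.sEdgeIn_symm htp
  have hqt := L.sEdgeIn_symm htq
  have hpt' := L.sEdgeIn_symm htp'
  have hqt' := L.sEdgeIn_symm htq'
  constructor
  · rintro ⟨h₁, -⟩ ⟨-, h₂⟩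
    exact L.not_cross hpt' htq h₁ h h₂
  · intro hn
    rcases L.lt_or_gt htp.1.ne with h₁ | h₁
    · rcases L.lt_or_gt htp'.1.ne with h₂ | h₂
      · exact (L.not_cross htp htq' h h₂ hpq).elim
      · rcases L.lt_or_gt htq'.1.ne with h₃ | h₃
        · exact (hn ⟨h₂, h₃⟩).elim
        · exact (L.not_cross htq hpt' h₁ hpq h₃).elim
    · refine ⟨h₁, (L.lt_or_gt htq.1.ne).resolve_right fun h₂ => ?_⟩
      exact L.not_cross hpt hqt' hpq h₂ h

/-- Two vertices have at most two common neighbors along stack-edges. -/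
theorem not_three_stack_common_neighbors {p q t₁ t₂ t₃ : V} (hpq : p ≠ q)
    (h₁₂ : t₁ ≠ t₂) (h₁₃ : t₁ ≠ t₃) (h₂₃ : t₂ ≠ t₃)
    (h₁ : StackAtt L t₁ p q) (h₂ : StackAtt L t₂ p q) (h₃ : StackAtt L t₃ p q) : False := by
  wlog h : L.lt p q generalizing p q
  · exact this hpq.symm h₁.symm h₂.symm h₃.symm ((L.lt_or_gt hpq).resolve_left h)
  have s₁₂ := L.stack_common_neighbors h h₁₂ h₁.1 h₁.2 h₂.1 h₂.2
  have s₁₃ := L.stack_common_neighbors h h₁₃ h₁.1 h₁.2 h₃.1 h₃.2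
  have s₂₃ := L.stack_common_neighbors h h₂₃ h₂.1 h₂.2 h₃.1 h₃.2
  tauto

end MixedLayout

/-- There is no vertex of `G(k+1,ℓ)` that is adjacent to `u` and strictly below a stack-edge
`{a,c}` for which `{u,a}`, `{c,v}` and `{u,v}` are queue-edges with `u ≺ a ≺ c ≺ v`. -/
theorem no_vertex_below {k ℓ : ℕ} (hl : 6 < ℓ) (L : MixedLayout (Gkl (k + 3) ℓ))
    {u a c v y : PV ℓ} (huv : QEdgeIn L (Gkl (k + 3) ℓ) u v)
    (hua : QEdgeIn L (Gkl (k + 3) ℓ) u a) (hcv : QEdgeIn L (Gkl (k + 3) ℓ) c v)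
    (hac : SEdgeIn L (Gkl (k + 3) ℓ) a c) (hlua : L.lt u a) (hlcv : L.lt c v)
    (hay : L.lt a y) (hyc : L.lt y c) (hyu : (Gkl (k + 1) ℓ).Adj y u) : False := by
  have below : ∀ {p q : PV ℓ}, L.lt a p → L.lt p c → (Gkl (k + 3) ℓ).Adj q p →
      q ∉ [a, c, u, v] → SEdgeIn L (Gkl (k + 3) ℓ) q p ∧ L.lt a q ∧ L.lt q c := by
    intro p q hap hpc hqp hq
    simp only [List.mem_cons, List.not_mem_nil, or_false, not_or] at hq
    obtain ⟨hqa, hqc, hqu, hqv⟩ := hq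
    obtain ⟨hs, h⟩ := L.neighbor_below huv hua hcv hac hlua hlcv hap hpc hqp.symm hqa hqc hqu hqv
    exact ⟨L.sEdgeIn_symm hs, h⟩
  obtain ⟨z, hz, hzy, -⟩ := Gkl_exists_attachment_notMem hyu [a, c, u, v]
    (by simp only [List.length_cons, List.length_nil]; omega)
  obtain ⟨-, haz, hzc⟩ := below hay hyc (Gkl_mono _ _ hzy) hz
  have attach : ∀ l : List (PV ℓ), l.length ≤ 2 →
      ∃ t, t ∉ l ∧ StackAtt L t z y := by
    intro l hlen
    obtain ⟨t, ht, htz, hty⟩ := Gkl_exists_attachment_notMem hzy ([a, c, u, v] ++ l)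
      (by simp only [List.length_append, List.length_cons, List.length_nil]; omega)
    rw [List.mem_append, not_or] at ht
    exact ⟨t, ht.2, (below haz hzc htz ht.1).1, (below hay hyc hty ht.1).1⟩
  obtain ⟨t₁, -, h₁⟩ := attach [] (by simp)
  obtain ⟨t₂, ht₂, h₂⟩ := attach [t₁] (by simp)
  obtain ⟨t₃, ht₃, h₃⟩ := attach [t₁, t₂] (by simp)
  simp only [List.mem_cons, List.not_mem_nil, or_false, not_or] at ht₂ ht₃
  exact L.not_three_stack_common_neighbors hzy.ne (Ne.symm ht₂) (Ne.symm ht₃.1)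
    (Ne.symm ht₃.2) h₁ h₂ h₃

/-- Claim 3: in the setting of Lemma 4, for `2 ≤ i ≤ 6` (here `1 ≤ j ≤ 5`) there is
no mixed-attachment `w` of `{v, x j}` with stack-edge `{w, x j}` and `x 6 ≺ w ≺ v`,
and no mixed-attachment `w` of `{u, x j}` with stack-edge `{w, x j}` and
`u ≺ w ≺ x 0`. -/
theorem claim_between_x7_v (k ℓ : ℕ) (hk : 4 < k) (hl : 6 < ℓ)
    (L : MixedLayout (Gkl k ℓ)) (u v : PV ℓ)
    (huv : QEdgeIn L (Gkl (k - 3) ℓ) u v) (huvlt : L.lt u v)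
    (x : Fin 7 → PV ℓ)
    (hatt : ∀ j, AttachedAt ℓ (k - 2) (x j) u v ∧ QueueAtt L (x j) u v)
    (hx0 : L.lt u (x 0)) (hx6 : L.lt (x 6) v)
    (hmono : ∀ j j' : Fin 7, j < j' → L.lt (x j) (x j')) :
    ∀ j : Fin 7, 1 ≤ (j : ℕ) → (j : ℕ) ≤ 5 →
      (¬∃ w : PV ℓ, AttachedAt ℓ (k - 1) w v (x j) ∧
        QEdgeIn L (Gkl k ℓ) w v ∧ SEdgeIn L (Gkl k ℓ) w (x j) ∧
        L.lt (x 6) w ∧ L.lt w v) ∧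
      (¬∃ w : PV ℓ, AttachedAt ℓ (k - 1) w u (x j) ∧
        QEdgeIn L (Gkl k ℓ) w u ∧ SEdgeIn L (Gkl k ℓ) w (x j) ∧
        L.lt u w ∧ L.lt w (x 0)) := by
  obtain ⟨n, rfl⟩ : ∃ n, k = n + 3 := ⟨k - 3, by omega⟩
  rw [show n + 3 - 3 = n by omega] at huv
  rw [show n + 3 - 2 = n + 1 by omega] at hatt
  obtain ⟨m, rfl⟩ : ∃ m, n = m + 1 := ⟨n - 1, by omega⟩
  have huv' : QEdgeIn L (Gkl (m + 1 + 3) ℓ) u v :=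
    ⟨Gkl_mono _ _ (Gkl_mono _ _ (Gkl_mono _ _ huv.1)), huv.2⟩
  have hadj : ∀ i, (Gkl (m + 1 + 1) ℓ).Adj (x i) u := fun i => Gbar_le_Gkl _ _ (hatt i).1.1
  intro j hj₁ hj₅
  have hj₀ : L.lt (x 0) (x j) := hmono 0 j (Fin.lt_def.2 (by simp; omega))
  have hj₆ : L.lt (x j) (x 6) := hmono j 6 (Fin.lt_def.2 (by simp; omega))
  refine ⟨?_, ?_⟩
  · rintro ⟨w, -, hwv, hwx, hw₆, hlwv⟩
    exact no_vertex_below hl L huv' (L.qEdgeIn_symm (hatt j).2.1) hwv (L.sEdgeIn_symm hwx)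
      (L.lt_trans hx0 hj₀) hlwv hj₆ hw₆ (hadj 6)
  · rintro ⟨w, -, hwu, hwx, hluw, hw₀⟩
    exact no_vertex_below hl L huv' (L.qEdgeIn_symm hwu) (hatt j).2.2 hwx
      hluw (L.lt_trans hj₆ hx6) hw₀ hj₀ (hadj 0)
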